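/- Let n, k ≥ 1, let S = {1_1 < 1_2 < … < 1_k < 2_1 < … < n_k} be a linearly ordered set of kn labels, and let R⋆_{kn} be the set of rooted forests on vertex set S such that for all j ∈ {1,…,n} and i ∈ {1,…,k−1}, vertex j_{i+1} is a child of vertex j_i. Define join: R⋆_{kn} → R_n^k by assigning colour k−i to each edge (j_i, r_s) with r ≠ j and then merging the vertices j_1,…,j_k into a single vertex labelled j, for each j. Then join is a bijection, and for every F⋆ ∈ R⋆_{kn} with F = join(F⋆): comaj(F⋆) = n·C(k,2) + k·comaj_k(F) and maj(F⋆) = k·maj(F). -/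

import Mathlib

/-- A rooted forest on vertex set `V`, encoded by its parent function:
`parent v = some u` means `u` is the parent of `v` (edges are directed away from
the roots, so `(u,v)` is an edge), and `parent v = none` means `v` is a root.
Acyclicity guarantees that every connected component is a tree with a
distinguished root. -/
structure RootedForest (V : Type) where
  parent : V → Option V
  acyclic : ∀ v : V, ¬ Relation.TransGen (fun a b : V => parent a = some b) v v

namespace RootedForest

variable {V : Type} [Fintype V] [LinearOrder V]

/-- `F.Desc u v` means `v` is a (strict) descendant of `u`. -/
def Desc (F : RootedForest V) (u v : V) : Prop :=
  Relation.TransGen (fun a b : V => F.parent a = some b) v u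

/-- The hook of `u`: `u` together with all of its descendants. -/
def hook (F : RootedForest V) (u : V) : Set V := {v : V | v = u ∨ F.Desc u v}

/-- The hook length `h(u)`. -/
noncomputable def h (F : RootedForest V) (u : V) : ℕ := (F.hook u).ncard

/-- The left hook length `h_L(u)`: sum of hook lengths of children smaller than `u`. -/
noncomputable def hL (F : RootedForest V) (u : V) : ℕ :=
  ∑ v ∈ Finset.univ.filter (fun v : V => F.parent v = some u ∧ v < u), F.h v

/-- The right hook length `h_R(u)`: sum of hook lengths of children larger than `u`. -/
noncomputable def hR (F : RootedForest V) (u : V) : ℕ :=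
  ∑ v ∈ Finset.univ.filter (fun v : V => F.parent v = some u ∧ u < v), F.h v

/-- The major index of a rooted forest. -/
noncomputable def maj (F : RootedForest V) : ℕ := ∑ u : V, F.hL u

/-- The comajor index of a rooted forest. -/
noncomputable def comaj (F : RootedForest V) : ℕ := ∑ u : V, F.hR u

/-- The number of inversions: pairs `(u,v)` with `v` a descendant of `u` and `v < u`. -/
noncomputable def inv (F : RootedForest V) : ℕ :=
  {p : V × V | F.Desc p.1 p.2 ∧ p.2 < p.1}.ncard

/-- The number of coinversions: pairs `(u,v)` with `v` a descendant of `u` and `v > u`. -/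
noncomputable def coinv (F : RootedForest V) : ℕ :=
  {p : V × V | F.Desc p.1 p.2 ∧ p.1 < p.2}.ncard

/-- The number of connected components (= number of roots). -/
def comps (F : RootedForest V) : ℕ :=
  (Finset.univ.filter (fun v : V => F.parent v = none)).card

end RootedForest

/-- A `k`-forest on vertex set `Fin n` (vertices `1,…,n`): a rooted forest together with a
colour in `{0,…,k-1}` on each edge.  The colour of the edge `(parent v, v)` is recorded
at the vertex `v`; roots carry the dummy colour `0`. -/
structure KForest (n k : ℕ) extends RootedForest (Fin n) where
  colour : Fin n → ℕ
  colour_lt : ∀ v, colour v < k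
  colour_root : ∀ v, parent v = none → colour v = 0

namespace KForest

variable {n k : ℕ}

/-- The chromatic depth `chr_k(F) = ∑_{(u,v) ∈ E(F)} κ(u,v)·h(v)`. -/
noncomputable def chr (F : KForest n k) : ℕ :=
  ∑ v ∈ Finset.univ.filter (fun v : Fin n => F.parent v ≠ none),
    F.colour v * F.toRootedForest.h v

/-- The chromatic codepth `cochr_k(F) = ∑_{(u,v) ∈ E(F)} (k-1-κ(u,v))·h(v)`. -/
noncomputable def cochr (F : KForest n k) : ℕ :=
  ∑ v ∈ Finset.univ.filter (fun v : Fin n => F.parent v ≠ none),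
    (k - 1 - F.colour v) * F.toRootedForest.h v

/-- `maj_k = maj + chr_k`. -/
noncomputable def majk (F : KForest n k) : ℕ := F.toRootedForest.maj + F.chr

/-- `comaj_k = comaj + cochr_k`. -/
noncomputable def comajk (F : KForest n k) : ℕ := F.toRootedForest.comaj + F.cochr

/-- `inv_k = inv + chr_k`. -/
noncomputable def invk (F : KForest n k) : ℕ := F.toRootedForest.inv + F.chr

/-- `coinv_k = coinv + cochr_k`. -/
noncomputable def coinvk (F : KForest n k) : ℕ := F.toRootedForest.coinv + F.cochr

end KForest

/-- A minimal factorization of the long cycle `(0 1 ⋯ n)` on `{0,1,…,n}` into `n`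
transpositions `(aᵢ bᵢ)` with `aᵢ < bᵢ`, multiplied left to right (the leftmost factor
is applied first, which corresponds to the reversed product in Mathlib's convention). -/
structure MinFact (n : ℕ) where
  a : Fin n → Fin (n+1)
  b : Fin n → Fin (n+1)
  ab_lt : ∀ i, a i < b i
  prod_eq : (List.ofFn (fun i => Equiv.swap (a i) (b i))).reverse.prod = finRotate (n+1)

namespace MinFact

variable {n : ℕ}

/-- `area(f) = C(n,2) - ∑ aᵢ`. -/
def area (f : MinFact n) : ℤ := (n.choose 2 : ℤ) - ∑ i : Fin n, ((f.a i : ℕ) : ℤ)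

/-- `coarea(f) = ∑ (bᵢ - 1) - C(n,2)`. -/
def coarea (f : MinFact n) : ℤ :=
  (∑ i : Fin n, (((f.b i : ℕ) : ℤ) - 1)) - (n.choose 2 : ℤ)

end MinFact

/-- A minimal `k`-factorization of the long cycle `(0 1 ⋯ kn)` on `{0,1,…,kn}` into `n`
cycles of length `k+1`: the `j`-th factor is the cycle `(a j 0, a j 1, …, a j k)`
(sending `a j 0 ↦ a j 1 ↦ ⋯ ↦ a j k ↦ a j 0`), presented with its least element first,
and the factors are multiplied left to right (leftmost applied first). -/
structure MinKFact (n k : ℕ) where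
  a : Fin n → Fin (k+1) → Fin (k*n+1)
  inj : ∀ j, Function.Injective (a j)
  min_first : ∀ j i, a j 0 ≤ a j i
  prod_eq :
    (List.ofFn (fun j => (List.ofFn (a j)).formPerm)).reverse.prod = finRotate (k*n+1)

namespace MinKFact

variable {n k : ℕ}

/-- `area_k(f) = C(kn,2) - n·C(k,2) - k·∑_j a_j^0`. -/
def areak (f : MinKFact n k) : ℤ :=
  ((k*n).choose 2 : ℤ) - n * (k.choose 2 : ℤ) - k * ∑ j : Fin n, ((f.a j 0 : ℕ) : ℤ)

/-- `coarea_k(f) = k·∑_j (a_j^k - 1) - C(kn,2) - n·C(k,2)`. -/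
def coareak (f : MinKFact n k) : ℤ :=
  k * (∑ j : Fin n, (((f.a j (Fin.last k) : ℕ) : ℤ) - 1))
    - ((k*n).choose 2 : ℤ) - n * (k.choose 2 : ℤ)

/-- `semiarea_k(f) = C(kn,2) - ∑_{i=0}^{k-1} ∑_j a_j^i`. -/
def semiareak (f : MinKFact n k) : ℤ :=
  ((k*n).choose 2 : ℤ) - ∑ i : Fin k, ∑ j : Fin n, ((f.a j i.castSucc : ℕ) : ℤ)

/-- `cosemiarea_k(f) = ∑_{i=1}^{k} ∑_j (a_j^i - 1) - C(kn,2)`. -/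
def cosemiareak (f : MinKFact n k) : ℤ :=
  (∑ i : Fin k, ∑ j : Fin n, (((f.a j i.succ : ℕ) : ℤ) - 1)) - ((k*n).choose 2 : ℤ)

end MinKFact

/-- `p` is a `k`-parking function: its nondecreasing rearrangement `b = p ∘ sort p`
satisfies `b i ≤ k * i` (with 0-indexed `i`, matching `bᵢ ≤ k(i-1)` for 1-indexed `i`). -/
def IsParkingFunction (k : ℕ) {n : ℕ} (p : Fin n → ℕ) : Prop :=
  ∀ i : Fin n, p (Tuple.sort p i) ≤ k * i

/-- The displacement `disp_k(p) = k·C(n,2) - ∑ᵢ aᵢ` of a `k`-parking function. -/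
def dispk (k : ℕ) {n : ℕ} (p : Fin n → ℕ) : ℤ :=
  k * (n.choose 2 : ℤ) - ∑ i : Fin n, (p i : ℤ)

instance (n k : ℕ) : Fintype (Fin n ×ₗ Fin k) := inferInstanceAs (Fintype (Fin n × Fin k))

/-- The set `R⋆_{kn}`: rooted forests on the lexicographically ordered label set
`S = {1_1 < ⋯ < 1_k < 2_1 < ⋯ < n_k}` (label `j_{i+1}` is `toLex (j, i)`, 0-indexed)
in which `j_{i+1}` is a child of `j_i` for all `j` and all `1 ≤ i ≤ k-1`. -/
def ChainDown (n k : ℕ) (Fs : RootedForest (Fin n ×ₗ Fin k)) : Prop :=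
  ∀ (j : Fin n) (i : Fin k) (hi : (i : ℕ) + 1 < k),
    Fs.parent (toLex (j, ⟨(i : ℕ) + 1, hi⟩)) = some (toLex (j, i))

namespace JoinAux

open Relation Finset

/-- The parent relation. -/
abbrev R {V : Type} (F : RootedForest V) : V → V → Prop := fun a b => F.parent a = some b

lemma mem_hook {V : Type} (F : RootedForest V) (u v : V) :
    v ∈ F.hook u ↔ ReflTransGen (R F) v u := by
  rw [reflTransGen_iff_eq_or_transGen]
  simp only [RootedForest.hook, RootedForest.Desc, Set.mem_ofPred_eq]
  constructor
  · rintro (h | h)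
    · exact Or.inl h.symm
    · exact Or.inr h
  · rintro (h | h)
    · exact Or.inl h.symm
    · exact Or.inr h

lemma h_rec {V : Type} [Fintype V] [DecidableEq V] (F : RootedForest V) (u : V) :
    F.h u = 1 + ∑ v, if F.parent v = some u then F.h v else 0 := by
  classical
  have hc : ∀ v, F.h v = (univ.filter fun w => ReflTransGen (R F) w v).card := by
    intro v
    rw [RootedForest.h, ← Set.ncard_coe_finset]
    congr 1
    ext w
    simp [mem_hook]
  have hs : (univ.filter fun w => ReflTransGen (R F) w u) =
      insert u ((univ.filter fun v => F.parent v = some u).biUnion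
        fun v => univ.filter fun w => ReflTransGen (R F) w v) := by
    ext w
    simp only [mem_filter, mem_univ, true_and, mem_insert, mem_biUnion]
    constructor
    · intro h
      rcases ReflTransGen.cases_tail h with h | ⟨c, h1, h2⟩
      · exact Or.inl h.symm
      · exact Or.inr ⟨c, h2, h1⟩
    · rintro (rfl | ⟨c, h2, h1⟩)
      · exact ReflTransGen.refl
      · exact h1.tail h2
  rw [hc u, hs, card_insert_of_notMem, card_biUnion, sum_filter, add_comm]
  · simp only [← hc]
  · have key : ∀ x y, F.parent x = some u → F.parent y = some u → x ≠ y →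
        ReflTransGen (R F) x y → False := by
      intro x y hx hy hxy h
      rcases ReflTransGen.cases_head h with h | ⟨c, h1, h2⟩
      · exact hxy h
      · have : c = u := by
          have := h1.symm.trans hx
          exact Option.some.inj this
        subst this
        exact F.acyclic _ (TransGen.tail' h2 hy)
    intro x hx y hy hxy
    simp only [coe_filter, mem_filter, mem_univ, true_and, Set.mem_ofPred_eq] at hx hy
    change Disjoint (univ.filter fun w => ReflTransGen (R F) w x)
      (univ.filter fun w => ReflTransGen (R F) w y)
    rw [Finset.disjoint_left]
    intro w hw hw'
    simp only [mem_filter, mem_univ, true_and] at hw hw'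
    have ru : Relator.RightUnique (R F) := by
      intro a b c h1 h2
      exact Option.some.inj (h1.symm.trans h2)
    rcases ReflTransGen.total_of_right_unique ru hw hw' with h | h
    · exact key x y hx hy hxy h
    · exact key y x hy hx hxy.symm h
  · simp only [mem_filter, mem_univ, true_and, mem_biUnion, not_exists, not_and]
    intro c hc h
    exact F.acyclic _ (TransGen.tail' h hc)

lemma maj_eq {V : Type} [Fintype V] [LinearOrder V] (F : RootedForest V) :
    F.maj = ∑ v, (F.parent v).elim 0 (fun u => if v < u then F.h v else 0) := by
  simp only [RootedForest.maj, RootedForest.hL, sum_filter]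
  rw [sum_comm]
  refine sum_congr rfl fun v _ => ?_
  rcases hv : F.parent v with _ | p
  · simp
  · rw [sum_eq_single p]
    · simp
    · intro b _ hb
      simp [hb.symm]
    · simp

lemma comaj_eq {V : Type} [Fintype V] [LinearOrder V] (F : RootedForest V) :
    F.comaj = ∑ v, (F.parent v).elim 0 (fun u => if u < v then F.h v else 0) := by
  simp only [RootedForest.comaj, RootedForest.hR, sum_filter]
  rw [sum_comm]
  refine sum_congr rfl fun v _ => ?_
  rcases hv : F.parent v with _ | p
  · simp
  · rw [sum_eq_single p]
    · simp
    · intro b _ hb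
      simp [hb.symm]
    · simp

variable {n m : ℕ}

lemma chain (Fs : RootedForest (Fin n ×ₗ Fin (m+1))) (hF : ChainDown n (m+1) Fs)
    (j : Fin n) (i : Fin m) : Fs.parent (toLex (j, i.succ)) = some (toLex (j, i.castSucc)) :=
  hF j i.castSucc (by simp)

lemma chain_up (Fs : RootedForest (Fin n ×ₗ Fin (m+1))) (hF : ChainDown n (m+1) Fs)
    (j : Fin n) (i : Fin (m+1)) : ReflTransGen (R Fs) (toLex (j, i)) (toLex (j, 0)) := by
  induction i using Fin.induction with
  | zero => exact ReflTransGen.refl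
  | succ i ih => exact ReflTransGen.head (chain Fs hF j i) ih

/-- The join map. -/
def join (Fs : RootedForest (Fin n ×ₗ Fin (m+1))) (hF : ChainDown n (m+1) Fs) :
    KForest n (m+1) where
  parent r := (Fs.parent (toLex (r, 0))).map (fun p => (ofLex p).1)
  colour r := (Fs.parent (toLex (r, 0))).elim 0 (fun p => m - ((ofLex p).2 : ℕ))
  colour_lt v := by
    rcases Fs.parent (toLex (v, 0)) with _ | p
    · simp
    · change m - _ < m + 1
      omega
  colour_root v hv := by
    rw [Option.map_eq_none_iff] at hv
    rw [hv]
    rfl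
  acyclic v hv := by
    refine Fs.acyclic (toLex (v, 0)) (TransGen.lift' (fun r => toLex (r, 0)) ?_ _ _ hv)
    intro a b hab
    obtain ⟨p, hp, rfl⟩ := Option.map_eq_some_iff.1 hab
    exact TransGen.head' hp (chain_up Fs hF (ofLex p).1 (ofLex p).2)

/-- The attaching position of `r`. -/
def idx (G : KForest n (m+1)) (r : Fin n) : Fin (m+1) := ⟨m - G.colour r, by omega⟩

/-- The parent function of the split forest. -/
def sp (G : KForest n (m+1)) (v : Fin n ×ₗ Fin (m+1)) : Option (Fin n ×ₗ Fin (m+1)) :=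
  Fin.cases (motive := fun _ => Option (Fin n ×ₗ Fin (m+1)))
    ((G.parent (ofLex v).1).map fun u => toLex (u, idx G (ofLex v).1))
    (fun i => some (toLex ((ofLex v).1, i.castSucc))) (ofLex v).2

lemma sp_zero (G : KForest n (m+1)) (r : Fin n) :
    sp G (toLex (r, 0)) = (G.parent r).map fun u => toLex (u, idx G r) := rfl

lemma sp_succ (G : KForest n (m+1)) (r : Fin n) (i : Fin m) :
    sp G (toLex (r, i.succ)) = some (toLex (r, i.castSucc)) := rfl

lemma sp_step (G : KForest n (m+1)) (a b : Fin n ×ₗ Fin (m+1)) (h : sp G a = some b) :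
    R G.toRootedForest (ofLex a).1 (ofLex b).1 ∨
      ((ofLex a).1 = (ofLex b).1 ∧ (ofLex b).2 < (ofLex a).2) := by
  obtain ⟨r, i⟩ := a
  change sp G (toLex (r, i)) = some b at h
  induction i using Fin.cases with
  | zero =>
    rw [sp_zero] at h
    obtain ⟨u, hu, rfl⟩ := Option.map_eq_some_iff.1 h
    exact Or.inl hu
  | succ i =>
    rw [sp_succ] at h
    obtain rfl := Option.some.inj h
    exact Or.inr ⟨rfl, Fin.castSucc_lt_succ⟩

lemma sp_trans (G : KForest n (m+1)) (a b : Fin n ×ₗ Fin (m+1))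
    (h : TransGen (fun a b => sp G a = some b) a b) :
    TransGen (R G.toRootedForest) (ofLex a).1 (ofLex b).1 ∨
      ((ofLex a).1 = (ofLex b).1 ∧ (ofLex b).2 < (ofLex a).2) := by
  induction h with
  | single h =>
    rcases sp_step G _ _ h with h | h
    · exact Or.inl (TransGen.single h)
    · exact Or.inr h
  | tail _ h ih =>
    rcases sp_step G _ _ h with h | h
    · rcases ih with ih | ih
      · exact Or.inl (ih.tail h)
      · rw [ih.1]
        exact Or.inl (TransGen.single h)
    · rcases ih with ih | ih
      · rw [← h.1]
        exact Or.inl ih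
      · exact Or.inr ⟨ih.1.trans h.1, h.2.trans ih.2⟩

/-- The split map. -/
def split (G : KForest n (m+1)) : RootedForest (Fin n ×ₗ Fin (m+1)) where
  parent := sp G
  acyclic v hv := by
    rcases sp_trans G _ _ hv with h | h
    · exact G.acyclic _ h
    · exact lt_irrefl _ h.2

lemma split_chain (G : KForest n (m+1)) : ChainDown n (m+1) (split G) := by
  intro j i hi
  exact sp_succ G j ⟨i, by omega⟩

lemma forest_ext {V : Type} {F G : RootedForest V} (h : ∀ v, F.parent v = G.parent v) :
    F = G := by
  cases F; cases G
  congr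
  exact funext h

lemma split_join (Fs : RootedForest (Fin n ×ₗ Fin (m+1))) (hF : ChainDown n (m+1) Fs) :
    split (join Fs hF) = Fs := by
  apply forest_ext
  rintro ⟨r, i⟩
  change sp _ (toLex (r, i)) = Fs.parent (toLex (r, i))
  induction i using Fin.cases with
  | zero =>
    rw [sp_zero]
    have h1 : (join Fs hF).parent r =
      (Fs.parent (toLex (r, 0))).map (fun p => (ofLex p).1) := rfl
    have h2 : (join Fs hF).colour r =
      (Fs.parent (toLex (r, 0))).elim 0 (fun p => m - ((ofLex p).2 : ℕ)) := rfl
    rw [h1]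
    rcases hp : Fs.parent (toLex (r, 0)) with _ | p
    · rfl
    · obtain ⟨j, i⟩ := p
      refine congrArg some (congrArg toLex (Prod.ext rfl (Fin.ext ?_)))
      change m - (join Fs hF).colour r = i
      rw [h2, hp]
      change m - (m - (i : ℕ)) = i
      omega
  | succ i =>
    rw [sp_succ, chain Fs hF]

lemma join_split (G : KForest n (m+1)) : join (split G) (split_chain G) = G := by
  have h1 : ∀ r, (join (split G) (split_chain G)).parent r = G.parent r := by
    intro r
    change (sp G (toLex (r, 0))).map _ = _
    rw [sp_zero, Option.map_map]
    exact Option.map_id' ..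
  have h2 : ∀ r, (join (split G) (split_chain G)).colour r = G.colour r := by
    intro r
    change ((sp G (toLex (r, 0))).elim 0 (fun p => m - ((ofLex p).2 : ℕ))) = _
    rw [sp_zero]
    rcases hp : G.parent r with _ | p
    · simp [G.colour_root r hp]
    · have := G.colour_lt r
      change m - (m - G.colour r) = G.colour r
      omega
  have h3 := forest_ext h1
  generalize join (split G) (split_chain G) = G' at *
  cases G'; cases G
  simp only at h2 h3
  subst h3
  congr
  exact funext h2

lemma sum_lex (f : Fin n ×ₗ Fin (m+1) → ℕ) :
    ∑ v, f v = ∑ r, (f (toLex (r, 0)) + ∑ i : Fin m, f (toLex (r, i.succ))) := by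
  have : ∑ v, f v = ∑ p : Fin n × Fin (m+1), f (toLex p) := rfl
  rw [this, Fintype.sum_prod_type]
  simp only [Fin.sum_univ_succ]

lemma h_zero (G : KForest n (m+1)) (r : Fin n) :
    (split G).h (toLex (r, 0)) = (m+1) * G.toRootedForest.h r := by
  have hs : (split G).hook (toLex (r, 0)) =
      Set.image toLex ((G.toRootedForest.hook r) ×ˢ (Set.univ : Set (Fin (m+1)))) := by
    ext v
    obtain ⟨⟨a, i⟩, rfl⟩ := toLex.surjective v
    rw [mem_hook]
    have : toLex (a, i) ∈
        Set.image toLex ((G.toRootedForest.hook r) ×ˢ (Set.univ : Set (Fin (m+1)))) ↔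
        a ∈ G.toRootedForest.hook r := by
      constructor
      · rintro ⟨⟨b, j⟩, hb, h⟩
        have : b = a := congrArg Prod.fst h
        subst this
        exact hb.1
      · intro h
        exact ⟨(a, i), ⟨h, trivial⟩, rfl⟩
    rw [this, mem_hook]
    constructor
    · intro h
      rcases reflTransGen_iff_eq_or_transGen.1 h with h | h
      · have : r = a := congrArg Prod.fst h
        rw [this]
      · rcases sp_trans G _ _ h with h | h
        · exact h.to_reflTransGen
        · have : a = r := h.1
          rw [this]
    · intro h
      refine (chain_up (split G) (split_chain G) a i).trans ?_
      refine ReflTransGen.lift' (fun r => toLex (r, 0)) ?_ _ _ h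
      intro a b hab
      refine ReflTransGen.head (b := toLex (b, idx G a)) ?_
        (chain_up (split G) (split_chain G) _ _)
      change sp G _ = _
      rw [sp_zero, hab]
      rfl
  rw [RootedForest.h, hs, Set.ncard_image_of_injective _ toLex.injective, Set.ncard_prod,
    Set.ncard_univ, Nat.card_fin, mul_comm]
  rfl

lemma h_gen (G : KForest n (m+1)) (j : Fin n) (d : ℕ) : ∀ (i : Fin (m+1)), (i : ℕ) + d = m →
    (split G).h (toLex (j, i)) = (d + 1) +
      ∑ r, if G.parent r = some j ∧ i ≤ idx G r then (m+1) * G.toRootedForest.h r else 0 := by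
  have hrec : ∀ i : Fin (m+1), (split G).h (toLex (j, i)) =
      1 + ((∑ r, if G.parent r = some j ∧ idx G r = i then
        (m+1) * G.toRootedForest.h r else 0) +
        ∑ i' : Fin m, if i'.castSucc = i then (split G).h (toLex (j, i'.succ)) else 0) := by
    intro i
    rw [h_rec, sum_lex, sum_add_distrib]
    congr 2
    · refine sum_congr rfl fun r _ => ?_
      rw [h_zero]
      refine if_congr ?_ rfl rfl
      change sp G _ = _ ↔ _
      rw [sp_zero, Option.map_eq_some_iff]
      constructor
      · rintro ⟨a, h1, h2⟩
        have h3 : a = j := congrArg (fun p => (ofLex p).1) h2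
        have h4 : idx G r = i := congrArg (fun p => (ofLex p).2) h2
        subst h3
        exact ⟨h1, h4⟩
      · rintro ⟨h1, h2⟩
        exact ⟨j, h1, by rw [h2]⟩
    · rw [sum_comm]
      refine sum_congr rfl fun i' _ => ?_
      rw [sum_eq_single j]
      · refine if_congr ?_ rfl rfl
        change some (toLex (j, i'.castSucc)) = _ ↔ _
        simp
      · intro b _ hb
        rw [if_neg]
        change ¬ some (toLex (b, i'.castSucc)) = _
        simp [hb]
      · simp
  induction d with
  | zero =>
    intro i hi
    rw [hrec]
    have : ∀ i' : Fin m, i'.castSucc ≠ i := by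
      intro i' h
      have := congrArg Fin.val h
      simp at this
      omega
    simp only [this, if_false, sum_const_zero, add_zero, zero_add]
    congr 1
    refine sum_congr rfl fun r _ => if_congr (and_congr_right fun _ => ?_) rfl rfl
    rw [Fin.ext_iff, Fin.le_def]
    have := (idx G r).2
    omega
  | succ d ih =>
    intro i hi
    rw [hrec, sum_eq_single (⟨i, by omega⟩ : Fin m)]
    · rw [if_pos (by ext; simp), ih _ (by simp; omega)]
      have : ∀ r, (if G.parent r = some j ∧ i ≤ idx G r then
            (m+1) * G.toRootedForest.h r else 0) =
          (if G.parent r = some j ∧ idx G r = i then (m+1) * G.toRootedForest.h r else 0) +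
          (if G.parent r = some j ∧ (⟨i, by omega⟩ : Fin m).succ ≤ idx G r then
            (m+1) * G.toRootedForest.h r else 0) := by
        intro r
        by_cases h1 : G.parent r = some j
        · simp only [h1, true_and, Fin.le_def, Fin.ext_iff, Fin.val_succ]
          split_ifs <;> omega
        · simp [h1]
      simp only [this, sum_add_distrib]
      ring
    · intro b _ hb
      rw [if_neg]
      rintro rfl
      exact hb rfl
    · simp

lemma parent_ne (G : KForest n (m+1)) (r : Fin n) : G.parent r ≠ some r :=
  fun h => G.acyclic r (TransGen.single h)

lemma maj_split (G : KForest n (m+1)) :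
    (split G).maj = (m+1) * G.toRootedForest.maj := by
  rw [maj_eq, maj_eq, sum_lex, mul_sum]
  refine sum_congr rfl fun r _ => ?_
  rw [sum_eq_zero, add_zero]
  · change ((sp G (toLex (r, 0))).elim 0 (fun u => if toLex (r, 0) < u then (split G).h (toLex (r, 0)) else 0)) = _
    rw [sp_zero, h_zero]
    rcases hp : G.parent r with _ | p
    · simp
    · have : r ≠ p := by
        rintro rfl
        exact parent_ne G _ hp
      simp [Prod.Lex.toLex_lt_toLex, this]
  · intro i _
    change (if toLex (r, i.succ) < toLex (r, i.castSucc) then _ else 0) = 0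
    rw [if_neg]
    simp [Prod.Lex.toLex_lt_toLex, Fin.castSucc_lt_succ.le]

lemma tail_sum (G : KForest n (m+1)) (j : Fin n) :
    ∑ i : Fin m, (split G).h (toLex (j, i.succ)) = (m+1).choose 2 +
      ∑ r, if G.parent r = some j then
        (m+1) * ((m - G.colour r) * G.toRootedForest.h r) else 0 := by
  have h1 : ∀ i : Fin m, (split G).h (toLex (j, i.succ)) = ((m - 1 - (i : ℕ)) + 1) +
      ∑ r, if G.parent r = some j ∧ i.succ ≤ idx G r then
        (m+1) * G.toRootedForest.h r else 0 :=
    fun i => h_gen G j _ i.succ (by simp; omega)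
  simp only [h1, sum_add_distrib]
  congr 1
  · rw [← sum_add_distrib, Fin.sum_univ_eq_sum_range (fun i => (m - 1 - i) + 1),
      sum_range_reflect (fun i => i + 1)]
    have : ∀ k, ∑ i ∈ range k, (i + 1) = (k + 1).choose 2 := by
      intro k
      induction k with
      | zero => rfl
      | succ k ih => rw [sum_range_succ, ih, Nat.choose_succ_succ (k + 1) 1]; simp; ring
    exact this m
  · rw [sum_comm]
    refine sum_congr rfl fun r _ => ?_
    by_cases h : G.parent r = some j
    · simp only [h, true_and, if_true]
      rw [← sum_filter, sum_const, smul_eq_mul]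
      have : (univ.filter fun i : Fin m => i.succ ≤ idx G r).card = m - G.colour r := by
        have : (univ.filter fun i : Fin m => i.succ ≤ idx G r) =
            univ.filter fun i : Fin m => (i : ℕ) < m - G.colour r := by
          ext i
          simp [Fin.le_def, idx]
        rw [this, Fin.card_filter_val_lt]
        omega
      rw [this]
      ring
    · simp [h]

lemma comaj_split (G : KForest n (m+1)) :
    (split G).comaj = n * (m+1).choose 2 + (m+1) * G.comajk := by
  have h1 : ∀ (r : Fin n) (i : Fin m), (((split G).parent (toLex (r, i.succ))).elim 0 (fun u => if u < toLex (r, i.succ) then (split G).h (toLex (r, i.succ)) else 0)) =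
      (split G).h (toLex (r, i.succ)) := by
    intro r i
    change (if toLex (r, i.castSucc) < toLex (r, i.succ) then _ else 0) = _
    rw [if_pos]
    simp [Prod.Lex.toLex_lt_toLex]
  rw [comaj_eq, KForest.comajk, comaj_eq, sum_lex, KForest.cochr, sum_filter]
  simp only [h1, tail_sum, sum_add_distrib, mul_add]
  rw [sum_const, card_univ, Fintype.card_fin, smul_eq_mul, add_left_comm,
    sum_comm (s := univ) (t := univ) (f := fun j r => if G.parent r = some j then
      (m+1) * ((m - G.colour r) * G.toRootedForest.h r) else 0)]
  congr 2
  · rw [mul_sum]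
    refine sum_congr rfl fun r _ => ?_
    change ((sp G (toLex (r, 0))).elim 0 (fun u => if u < toLex (r, 0) then (split G).h (toLex (r, 0)) else 0)) = _
    rw [sp_zero, h_zero]
    rcases hp : G.parent r with _ | p
    · simp
    · have : p ≠ r := by
        rintro rfl
        exact parent_ne G _ hp
      simp [Prod.Lex.toLex_lt_toLex, this]
  · rw [mul_sum]
    refine sum_congr rfl fun r _ => ?_
    rcases hp : G.parent r with _ | p
    · simp
    · simp

/-- The join bijection. -/
def joinEquiv (n m : ℕ) :
    {Fs : RootedForest (Fin n ×ₗ Fin (m+1)) // ChainDown n (m+1) Fs} ≃ KForest n (m+1) where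
  toFun Fs := join Fs.1 Fs.2
  invFun G := ⟨split G, split_chain G⟩
  left_inv Fs := Subtype.ext (split_join Fs.1 Fs.2)
  right_inv G := join_split G

end JoinAux

/-- The map `join : R⋆_{kn} → R_n^k` — which assigns colour `k - i` to each
edge `(j_i, r_s)` with `r ≠ j` and merges the vertices `j_1, …, j_k` into a single vertex
`j` (so that the parent of `r` is read off from the parent of the top vertex `r_1` of the
chain of `r`) — is a bijection, and for `F = join F⋆` one has
`comaj F⋆ = n·C(k,2) + k·comaj_k F` and `maj F⋆ = k·maj F`. -/
theorem stmt10 (n k : ℕ) (hn : 1 ≤ n) (hk : 1 ≤ k) :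
    ∃ join : {Fs : RootedForest (Fin n ×ₗ Fin k) // ChainDown n k Fs} ≃ KForest n k,
      ∀ Fs : {Fs : RootedForest (Fin n ×ₗ Fin k) // ChainDown n k Fs},
        (∀ r : Fin n,
          (join Fs).parent r =
            (Fs.1.parent (toLex (r, ⟨0, by omega⟩))).map (fun p => (ofLex p).1)) ∧
        (∀ (r j : Fin n) (i : Fin k),
          Fs.1.parent (toLex (r, ⟨0, by omega⟩)) = some (toLex (j, i)) →
            (join Fs).colour r = k - 1 - (i : ℕ)) ∧
        Fs.1.comaj = n * k.choose 2 + k * KForest.comajk (join Fs) ∧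
        Fs.1.maj = k * (join Fs).toRootedForest.maj := by
  obtain ⟨m, rfl⟩ : ∃ m, k = m + 1 := ⟨k - 1, by omega⟩
  refine ⟨JoinAux.joinEquiv n m, fun Fs => ⟨fun r => rfl, ?_, ?_, ?_⟩⟩
  · intro r j i h
    change (Fs.1.parent (toLex (r, 0))).elim 0 (fun p => m - ((ofLex p).2 : ℕ)) = _
    have h' : Fs.1.parent (toLex (r, 0)) = some (toLex (j, i)) := h
    rw [h']
    rfl
  · have := JoinAux.comaj_split (JoinAux.join Fs.1 Fs.2)
    rw [JoinAux.split_join] at this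
    exact this
  · have := JoinAux.maj_split (JoinAux.join Fs.1 Fs.2)
    rw [JoinAux.split_join] at this
    exact this
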